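/- arXiv:1112.0128 — 2 statements merged into one kernel-verified Lean document; each statement's English description precedes it below -/
import Mathlib

section
/- Let n > 2 and let p be a prime. There exists a constant C > 0, depending only on n, with the following property. Let q ≠ r be positive integers with p ∤ q and p ∤ r, and let j, k ≥ 1 be integers with p^{-j} ≤ p^{-k}, p^{-j} ≤ 1/q and p^{-k} ≤ 1/r. Define A_{q,n} := ⋃ B_δ(φ(y), p^{-j}) over all y ∈ ℤ^n_vis with y_n = q and |y_m| ≤ q for all m, and A_{r,n} := ⋃ B_δ(φ(y), p^{-k}) over all y ∈ ℤ^n_vis with y_n = r and |y_m| ≤ r for all m. Then μ_p(A_{q,n} ∩ A_{r,n}) ≤ C · (q r p^{-j} p^{-k})^{n-1}. -/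
open MeasureTheory

noncomputable section

/-- The p-adic projective distance (at vector level): the sup-norm of the wedge product
divided by the product of sup norms.  Invariant under scaling, it descends to
projective space. -/
def padicDelta (p : ℕ) [Fact p.Prime] {n : ℕ} (x y : Fin n → ℚ_[p]) : ℝ :=
  (⨆ ij : Fin n × Fin n, ‖x ij.1 * y ij.2 - x ij.2 * y ij.1‖) / (‖x‖ * ‖y‖)

instance (p : ℕ) [Fact p.Prime] (n : ℕ) : MeasurableSpace (Fin n → ℚ_[p]) := borel _
instance (p : ℕ) [Fact p.Prime] (n : ℕ) : BorelSpace (Fin n → ℚ_[p]) := ⟨rfl⟩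

/-- `ℤ_p^n` as a positive compact subset of `ℚ_p^n`. -/
def padicUnitPC (p : ℕ) [Fact p.Prime] (n : ℕ) :
    TopologicalSpace.PositiveCompacts (Fin n → ℚ_[p]) where
  carrier := {x | ∀ i, ‖x i‖ ≤ 1}
  isCompact' := by
    have : {x : Fin n → ℚ_[p] | ∀ i, ‖x i‖ ≤ 1} = Set.univ.pi fun _ => Metric.closedBall 0 1 := by
      ext x; simp [Metric.mem_closedBall, dist_eq_norm]
    rw [this]
    exact isCompact_univ_pi fun i => isCompact_closedBall 0 1
  interior_nonempty' := by
    refine ⟨0, ?_⟩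
    rw [mem_interior]
    refine ⟨Metric.ball 0 1, fun x hx i => ?_, Metric.isOpen_ball, by simp⟩
    have hx' : ‖x‖ < 1 := by simpa [dist_eq_norm] using hx
    exact le_of_lt (lt_of_le_of_lt (norm_le_pi_norm x i) hx')

/-- Haar measure on `ℚ_p^n`, normalized so that `ℤ_p^n` has measure one. -/
def padicHaar (p : ℕ) [Fact p.Prime] (n : ℕ) : Measure (Fin n → ℚ_[p]) :=
  Measure.addHaarMeasure (padicUnitPC p n)

/-- The natural probability measure `μ_p` on `ℙ^{n-1}(ℚ_p)`:
`μ_p(M) = β(φ⁻¹(M) ∩ ℤ_p^n)`. -/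
def muP (p : ℕ) [Fact p.Prime] (n : ℕ)
    (M : Set (Projectivization ℚ_[p] (Fin n → ℚ_[p]))) : ENNReal :=
  padicHaar p n {x | (∀ i, ‖x i‖ ≤ 1) ∧ ∃ hx : x ≠ 0, Projectivization.mk ℚ_[p] x hx ∈ M}

/-- A visible (primitive) integer vector: the gcd of its coordinates is 1. -/
def IsPrim {n : ℕ} (v : Fin n → ℤ) : Prop := Finset.univ.gcd v = 1

/-- The sup-norm height of an integer vector. -/
def Hsup {n : ℕ} (v : Fin n → ℤ) : ℕ := Finset.univ.sup fun i => (v i).natAbs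

/-- Embedding of an integer vector into `ℚ_p^n`. -/
def intPadic (p : ℕ) [Fact p.Prime] {n : ℕ} (v : Fin n → ℤ) : Fin n → ℚ_[p] :=
  fun i => ((v i : ℤ) : ℚ_[p])

/-- Embedding of an integer vector into `ℚ^n`. -/
def intRat {n : ℕ} (v : Fin n → ℤ) : Fin n → ℚ := fun i => ((v i : ℤ) : ℚ)

/-- The set `W_p(ψ, ℚ, n)` of points of `ℙ^{n-1}(ℚ_p)` admitting infinitely many
rational approximations `y` with `δ_p(x,y) ≤ ψ(H(y))`. -/
def Wp (p : ℕ) [Fact p.Prime] (n : ℕ) (ψ : ℕ → ℝ) :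
    Set (Projectivization ℚ_[p] (Fin n → ℚ_[p])) :=
  {x | {y : Projectivization ℚ (Fin n → ℚ) | ∃ v : Fin n → ℤ, IsPrim v ∧
      (∃ hv : intRat v ≠ 0, y = Projectivization.mk ℚ (intRat v) hv) ∧
      padicDelta p x.rep (intPadic p v) ≤ ψ (Hsup v)}.Infinite}

/-- Closed ball for the projective metric, centered at the class of the vector `y`. -/
def Bdelta (p : ℕ) [Fact p.Prime] {n : ℕ} (y : Fin n → ℚ_[p]) (r : ℝ) :
    Set (Projectivization ℚ_[p] (Fin n → ℚ_[p])) :=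
  {z | padicDelta p z.rep y ≤ r}

/-- The Euclidean norm of a vector in `ℝ^n`. -/
noncomputable def eNorm {n : ℕ} (x : Fin n → ℝ) : ℝ := Real.sqrt (∑ i, (x i) ^ 2)

/-- Norm of the wedge product of two vectors in `ℝ^n`:
`‖x ∧ y‖² = Σ_{i<j} (x_i y_j − x_j y_i)²`. -/
noncomputable def wedgeNorm {n : ℕ} (x y : Fin n → ℝ) : ℝ :=
  Real.sqrt (∑ ij ∈ Finset.univ.filter (fun ij : Fin n × Fin n => ij.1 < ij.2),
    (x ij.1 * y ij.2 - x ij.2 * y ij.1) ^ 2)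

/-- The projective distance at the infinite place (vector level):
`δ_∞(x,y) = ‖x ∧ y‖ / (‖x‖‖y‖)`. Invariant under scaling, it descends to `ℙ^{n-1}(ℝ)`. -/
noncomputable def deltaInf {n : ℕ} (x y : Fin n → ℝ) : ℝ :=
  wedgeNorm x y / (eNorm x * eNorm y)

/-- Embedding of an integer vector into `ℝ^n`. -/
noncomputable def intReal {n : ℕ} (v : Fin n → ℤ) : Fin n → ℝ := fun i => ((v i : ℤ) : ℝ)

/-- The natural probability measure `μ_∞` on `ℙ^{n-1}(ℝ)`:
`μ_∞(M) = λ(φ⁻¹(M) ∩ B(0,1)) / λ(B(0,1))`. -/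
noncomputable def muInf (n : ℕ) (M : Set (Projectivization ℝ (Fin n → ℝ))) : ENNReal :=
  MeasureTheory.volume {x : Fin n → ℝ | eNorm x ≤ 1 ∧
      ∃ hx : x ≠ 0, Projectivization.mk ℝ x hx ∈ M} /
    MeasureTheory.volume {x : Fin n → ℝ | eNorm x ≤ 1}

/-- The set `W_∞(ψ, ℚ, n)` of points of `ℙ^{n-1}(ℝ)` admitting infinitely many
rational approximations `y` with `δ_∞(x,y) ≤ ψ(H(y))`. -/
noncomputable def Winf (n : ℕ) (ψ : ℕ → ℝ) : Set (Projectivization ℝ (Fin n → ℝ)) :=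
  {x | {y : Projectivization ℚ (Fin n → ℚ) | ∃ v : Fin n → ℤ, IsPrim v ∧
      (∃ hv : intRat v ≠ 0, y = Projectivization.mk ℚ (intRat v) hv) ∧
      deltaInf x.rep (intReal v) ≤ ψ (Hsup v)}.Infinite}

/-- The Choi–Vaaler constant `c(n) = 2·π^{-1/2}·Γ(n/2+1)^{1/n}` for `k = ℚ`. -/
noncomputable def cCV (n : ℕ) : ℝ :=
  2 * Real.pi ^ (-(1/2 : ℝ)) * Real.Gamma ((n : ℝ) / 2 + 1) ^ ((1 : ℝ) / n)

/-- The Euclidean height of a primitive integer vector. -/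
noncomputable def He {n : ℕ} (v : Fin n → ℤ) : ℝ := eNorm (intReal v)

end

/-- Counting integer points of a box on a congruence: if the congruence `a r ≡ b q (mod P)` has a
solution in the box with `a r ≠ b q`, then it has at most `18 q r / P` solutions there. -/
theorem card_box_congruence_mul_le {q r P : ℕ} (hq : 1 ≤ q) (hr : 1 ≤ r) (hP : 1 ≤ P)
    (hcop : P.Coprime q) {a₀ b₀ : ℤ} (ha₀ : |a₀| ≤ q) (hb₀ : |b₀| ≤ r)
    (hdvd : (P : ℤ) ∣ a₀ * r - b₀ * q) (hne : a₀ * r ≠ b₀ * q) :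
    (((Finset.Icc (-(q : ℤ)) q ×ˢ Finset.Icc (-(r : ℤ)) r).filter
      fun c => (P : ℤ) ∣ c.1 * r - c.2 * q).card) * P ≤ 18 * (q * r) := by
  obtain ⟨g, q', r', hg, hqr', rfl, rfl⟩ := Nat.exists_coprime' (m := q) (n := r)
    (Nat.gcd_pos_of_pos_left _ hq)
  have hq' : 0 < q' := Nat.pos_of_mul_pos_right hq
  have hr' : 0 < r' := Nat.pos_of_mul_pos_right hr
  have hgcop : IsCoprime (P : ℤ) (g : ℤ) :=
    Nat.isCoprime_iff_coprime.2 hcop.coprime_mul_left_right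
  have hquot : ∀ a b : ℤ, (P : ℤ) ∣ a * ((r' * g : ℕ) : ℤ) - b * ((q' * g : ℕ) : ℤ) →
      (P : ℤ) ∣ a * r' - b * q' := by
    intro a b h
    apply hgcop.dvd_of_dvd_mul_right
    have : (a * r' - b * q') * (g : ℤ) = a * ((r' * g : ℕ) : ℤ) - b * ((q' * g : ℕ) : ℤ) := by
      push_cast
      ring
    rwa [this]
  have hbound : ∀ a b : ℤ, |a| ≤ ((q' * g : ℕ) : ℤ) → |b| ≤ ((r' * g : ℕ) : ℤ) →
      |a * r' - b * q'| ≤ 2 * (q' * g * r') := by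
    intro a b ha hb
    have h1 : |a * r'| ≤ (q' * g) * r' := by
      rw [abs_mul, Nat.abs_cast]
      push_cast at ha
      gcongr
    have h2 : |b * q'| ≤ (r' * g) * q' := by
      rw [abs_mul, Nat.abs_cast]
      push_cast at hb
      gcongr
    have := abs_sub (a * r') (b * q')
    nlinarith
  have hP0 : (0 : ℤ) < P := by exact_mod_cast hP
  set T : ℕ := 2 * (q' * g * r') / P with hT
  have hTP : T * P ≤ 2 * (q' * g * r') := Nat.div_mul_le_self _ _
  have hquotT : ∀ t : ℤ, |P * t| ≤ 2 * (q' * g * r') → |t| ≤ T := by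
    intro t ht
    rw [hT]
    push_cast
    rw [Int.le_ediv_iff_mul_le hP0]
    rwa [abs_mul, Nat.abs_cast, mul_comm] at ht
  have hT1 : 1 ≤ T := by
    obtain ⟨t, ht⟩ := hquot _ _ hdvd
    have h1 := hquotT t (ht ▸ hbound _ _ ha₀ hb₀)
    have h2 : t ≠ 0 := by
      rintro rfl
      apply hne
      push_cast
      linear_combination (g : ℤ) * ht
    have := Int.one_le_abs h2
    omega
  have hcard : ((Finset.Icc (-((q' * g : ℕ) : ℤ)) ((q' * g : ℕ) : ℤ) ×ˢ
      Finset.Icc (-((r' * g : ℕ) : ℤ)) ((r' * g : ℕ) : ℤ)).filter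
      fun c => (P : ℤ) ∣ c.1 * ((r' * g : ℕ) : ℤ) - c.2 * ((q' * g : ℕ) : ℤ)).card ≤
      (Finset.Icc (-(T : ℤ)) T ×ˢ Finset.Icc (-(g : ℤ)) g).card := by
    apply Finset.card_le_card_of_injOn
      (fun c => ((c.1 * r' - c.2 * q') / (P : ℤ), c.1 / (q' : ℤ)))
    · rintro ⟨a, b⟩ hab
      simp only [Finset.coe_filter, Finset.mem_product, Finset.mem_Icc, Set.mem_ofPred_eq] at hab
      obtain ⟨⟨ha, hb⟩, hd⟩ := hab
      have ha' := abs_le.2 ha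
      obtain ⟨t, ht⟩ := hquot _ _ hd
      have h1 := abs_le.1 (hquotT t (ht ▸ hbound _ _ ha' (abs_le.2 hb)))
      have hq0 : (0 : ℤ) < q' := by exact_mod_cast hq'
      simp only [Finset.coe_product, Finset.coe_Icc, Set.mem_prod, Set.mem_Icc, ht,
        Int.mul_ediv_cancel_left _ hP0.ne']
      push_cast at ha
      refine ⟨h1, ?_, ?_⟩
      · rw [Int.le_ediv_iff_mul_le hq0]
        linarith [ha.1]
      · exact Int.ediv_le_of_le_mul hq0 (by linarith [ha.2])
    · rintro ⟨a, b⟩ hab ⟨a', b'⟩ hab' h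
      simp only [Finset.coe_filter, Set.mem_ofPred_eq] at hab hab'
      simp only [Prod.mk.injEq] at h
      obtain ⟨t, ht⟩ := hquot _ _ hab.2
      obtain ⟨t', ht'⟩ := hquot _ _ hab'.2
      rw [ht, ht', Int.mul_ediv_cancel_left _ hP0.ne', Int.mul_ediv_cancel_left _ hP0.ne'] at h
      have hq0 : (q' : ℤ) ≠ 0 := by exact_mod_cast hq'.ne'
      have hlin : (a - a') * r' = (b - b') * q' := by
        linear_combination ht - ht' + (P : ℤ) * h.1
      have hdv : (q' : ℤ) ∣ a - a' :=
        (Nat.isCoprime_iff_coprime.2 hqr').dvd_of_dvd_mul_right ⟨b - b', by rw [hlin, mul_comm]⟩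
      have hmod : a % q' = a' % q' := Int.emod_eq_emod_iff_emod_sub_eq_zero.2 (Int.emod_eq_zero_of_dvd hdv)
      have haa : a = a' := by
        rw [← Int.mul_ediv_add_emod a q', ← Int.mul_ediv_add_emod a' q', h.2, hmod]
      subst haa
      have : (b - b') * (q' : ℤ) = 0 := by rw [← hlin]; ring
      rcases mul_eq_zero.1 this with h | h
      · rw [sub_eq_zero.1 h]
      · exact absurd h hq0
  have hcard' : (Finset.Icc (-(T : ℤ)) T ×ˢ Finset.Icc (-(g : ℤ)) g).card ≤ (3 * T) * (3 * g) := by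
    rw [Finset.card_product, Int.card_Icc, Int.card_Icc]
    apply Nat.mul_le_mul <;> omega
  calc _ ≤ (3 * T) * (3 * g) * P := Nat.mul_le_mul_right _ (hcard.trans hcard')
    _ = 9 * g * (T * P) := by ring
    _ ≤ 9 * g * (2 * (q' * g * r')) := by gcongr
    _ = _ := by ring

/-- Visible integer vectors are not proportional with distinct nonnegative factors. -/
theorem exists_mul_ne_mul_of_isPrim {n : ℕ} {v w : Fin n → ℤ} (hv : IsPrim v) (hw : IsPrim w)
    {q r : ℕ} (hqr : q ≠ r) : ∃ i, v i * r ≠ w i * q := by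
  by_contra! h
  have h1 : Finset.univ.gcd (fun i => v i * (r : ℤ)) = r := by
    rw [Finset.gcd_mul_right, hv, one_mul, Int.normalize_coe_nat]
  have h2 : Finset.univ.gcd (fun i => w i * (q : ℤ)) = q := by
    rw [Finset.gcd_mul_right, hw, one_mul, Int.normalize_coe_nat]
  rw [funext h, h2] at h1
  exact hqr (by exact_mod_cast h1)

section PadicBalls

variable {p : ℕ} [Fact p.Prime]

theorem norm_natCast_eq_one_of_not_dvd {q : ℕ} (hq : ¬ p ∣ q) : ‖(q : ℚ_[p])‖ = 1 :=
  Padic.norm_natCast_eq_one_iff.2 ((Fact.out : p.Prime).coprime_iff_not_dvd.2 hq)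

/-- The minors of a representative against an integer vector are controlled by membership in the
projective ball around that vector. -/
theorem norm_minor_le_of_mk_mem_Bdelta {n : ℕ} {x : Fin n → ℚ_[p]} (hx : x ≠ 0)
    {v : Fin n → ℤ} {s : ℝ} (hs : 0 ≤ s)
    (h : Projectivization.mk ℚ_[p] x hx ∈ Bdelta p (intPadic p v) s) (i l : Fin n)
    (hv : ‖(v l : ℚ_[p])‖ = 1) :
    ‖x i * v l - x l * v i‖ ≤ s * ‖x‖ := by
  obtain ⟨a, ha⟩ := Projectivization.exists_smul_eq_mk_rep ℚ_[p] x hx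
  have hy1 : ‖intPadic p v‖ ≤ 1 :=
    (pi_norm_le_iff_of_nonneg zero_le_one).2 fun i => Padic.norm_int_le_one _
  have hy0 : 0 < ‖intPadic p v‖ := by
    refine lt_of_lt_of_le zero_lt_one (hv.symm.le.trans ?_)
    exact norm_le_pi_norm (intPadic p v) l
  have ha0 : 0 < ‖(a : ℚ_[p])‖ := norm_pos_iff.2 a.ne_zero
  change padicDelta p _ _ ≤ s at h
  rw [← ha, padicDelta, Units.smul_def, norm_smul,
    div_le_iff₀ (mul_pos (mul_pos ha0 (norm_pos_iff.2 hx)) hy0)] at h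
  have h2 := (le_ciSup (f := fun ij : Fin n × Fin n =>
    ‖((a : ℚ_[p]) • x) ij.1 * intPadic p v ij.2 - ((a : ℚ_[p]) • x) ij.2 * intPadic p v ij.1‖)
    (Set.finite_range _).bddAbove (i, l)).trans h
  have h3 : ((a : ℚ_[p]) • x) i * intPadic p v l - ((a : ℚ_[p]) • x) l * intPadic p v i =
      a * (x i * v l - x l * v i) := by
    simp only [Pi.smul_apply, smul_eq_mul, intPadic]
    ring
  simp only [h3, norm_mul] at h2
  refine le_of_mul_le_mul_left ?_ ha0
  calc _ ≤ _ := h2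
    _ ≤ s * (‖(a : ℚ_[p])‖ * ‖x‖ * 1) := by gcongr
    _ = _ := by ring

/-- A vector near a vector with unit entry at `l` attains its norm at `l`. -/
theorem norm_eq_norm_apply_of_norm_minor_le {n : ℕ} {x : Fin n → ℚ_[p]} (hx : x ≠ 0)
    {v : Fin n → ℤ} {s : ℝ} (hs : s < 1) {l : Fin n} (hv : ‖(v l : ℚ_[p])‖ = 1)
    (h : ∀ i, ‖x i * v l - x l * v i‖ ≤ s * ‖x‖) : ‖x‖ = ‖x l‖ := by
  refine le_antisymm ?_ (norm_le_pi_norm x l)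
  have hx0 : 0 < ‖x‖ := norm_pos_iff.2 hx
  have hmax : ‖x‖ ≤ max (s * ‖x‖) ‖x l‖ := by
    have : 0 ≤ max (s * ‖x‖) ‖x l‖ := (norm_nonneg _).trans (le_max_right _ _)
    refine (pi_norm_le_iff_of_nonneg this).2 fun i => ?_
    calc ‖x i‖ = ‖(x i * v l - x l * v i) + x l * v i‖ := by
          rw [sub_add_cancel, norm_mul, hv, mul_one]
      _ ≤ max ‖x i * v l - x l * v i‖ ‖x l * v i‖ := Padic.nonarchimedean _ _
      _ ≤ _ := by
          refine max_le_max (h i) ?_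
          rw [norm_mul]
          exact mul_le_of_le_one_right (norm_nonneg _) (Padic.norm_int_le_one _)
  rcases le_max_iff.1 hmax with h | h
  · nlinarith
  · exact h

/-- If two projective balls around integer vectors meet, the vectors are congruent up to
scaling. -/
theorem dvd_of_norm_minor_le {n : ℕ} {x : Fin n → ℚ_[p]} (hx : x ≠ 0) {v w : Fin n → ℤ}
    {q r j k : ℕ} (hj : 1 ≤ j) (hkj : (p : ℝ) ^ (-(j : ℤ)) ≤ (p : ℝ) ^ (-(k : ℤ))) {l : Fin n}
    (hvq : v l = q) (hwr : w l = r) (hq : ¬ p ∣ q)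
    (hv : ∀ i, ‖x i * v l - x l * v i‖ ≤ (p : ℝ) ^ (-(j : ℤ)) * ‖x‖)
    (hw : ∀ i, ‖x i * w l - x l * w i‖ ≤ (p : ℝ) ^ (-(k : ℤ)) * ‖x‖) (i : Fin n) :
    ((p ^ k : ℕ) : ℤ) ∣ v i * r - w i * q := by
  have hp1 : (1 : ℝ) < p := by exact_mod_cast (Fact.out : p.Prime).one_lt
  have hx0 : 0 < ‖x‖ := norm_pos_iff.2 hx
  have hxl : ‖x‖ = ‖x l‖ := by
    refine norm_eq_norm_apply_of_norm_minor_le hx (zpow_lt_one_of_neg₀ hp1 (by omega)) ?_ hv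
    rw [hvq]
    exact_mod_cast norm_natCast_eq_one_of_not_dvd hq
  push_cast
  rw [← Padic.norm_int_le_pow_iff_dvd (p := p)]
  refine le_of_mul_le_mul_left ?_ hx0
  rw [mul_comm ‖x‖ ((p : ℝ) ^ _)]
  have key : x l * ((v i * r - w i * q : ℤ) : ℚ_[p]) =
      (x i * w l - x l * w i) * v l + -((x i * v l - x l * v i) * w l) := by
    rw [hvq, hwr]
    push_cast
    ring
  calc ‖x‖ * ‖((v i * r - w i * q : ℤ) : ℚ_[p])‖
      = ‖(x i * w l - x l * w i) * v l + -((x i * v l - x l * v i) * w l)‖ := by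
        rw [hxl, ← norm_mul, key]
    _ ≤ max ‖(x i * w l - x l * w i) * v l‖ ‖-((x i * v l - x l * v i) * w l)‖ :=
        Padic.nonarchimedean _ _
    _ ≤ (p : ℝ) ^ (-(k : ℤ)) * ‖x‖ := by
        rw [norm_neg, norm_mul, norm_mul]
        refine max_le ?_ ?_
        · exact (mul_le_of_le_one_right (norm_nonneg _) (Padic.norm_int_le_one _)).trans (hw i)
        · refine (mul_le_of_le_one_right (norm_nonneg _) (Padic.norm_int_le_one _)).trans
            ((hv i).trans ?_)
          gcongr

/-- The cone over a projective ball around `(y_1, …, y_m, q)`, cut by `ℤ_p^{m+1}`. -/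
def ballCone (p : ℕ) [Fact p.Prime] {m : ℕ} (q j : ℕ) (y : Fin m → ℤ) :
    Set (Fin (m + 1) → ℚ_[p]) :=
  {x | (∀ i, ‖x i‖ ≤ 1) ∧
    ∀ i : Fin m, ‖x i.castSucc * q - x (Fin.last m) * y i‖ ≤ (p : ℝ) ^ (-(j : ℤ))}

theorem isClosed_ballCone {m : ℕ} (q j : ℕ) (y : Fin m → ℤ) : IsClosed (ballCone p q j y) := by
  simp only [ballCone, Set.ofPred_and, Set.ofPred_forall]
  refine IsClosed.inter (isClosed_iInter fun i => isClosed_le (by fun_prop) (by fun_prop))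
    (isClosed_iInter fun i => isClosed_le (by fun_prop) (by fun_prop))

theorem padicHaar_ballCone_le {m q : ℕ} (hq : ¬ p ∣ q) (j : ℕ) (y : Fin m → ℤ) :
    ((p ^ j : ℕ) : ENNReal) ^ m * padicHaar p (m + 1) (ballCone p q j y) ≤ 1 := by
  have : (padicHaar p (m + 1)).IsAddLeftInvariant := by
    unfold padicHaar
    infer_instance
  let shift : (Fin m → Fin (p ^ j)) → Fin (m + 1) → ℚ_[p] :=
    fun a => Fin.snoc (fun i => ((a i : ℕ) : ℚ_[p])) 0
  have hshift : ∀ a i, ‖shift a i‖ ≤ 1 := by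
    intro a i
    refine Fin.lastCases ?_ (fun i => ?_) i
    · simp [shift]
    · simpa [shift] using Padic.norm_int_le_one (p := p) ((a i : ℕ) : ℤ)
  have hdisj : Pairwise (Function.onFun Disjoint
      fun a => (fun x => shift a + x) ⁻¹' ballCone p q j y) := by
    intro a b hab
    refine Set.disjoint_left.2 fun x hxa hxb => hab (funext fun i => ?_)
    have h1 := hxa.2 i
    have h2 := hxb.2 i
    simp only [shift, Pi.add_apply, Fin.snoc_castSucc, Fin.snoc_last, zero_add] at h1 h2
    have h3 : ‖(((a i : ℕ) - (b i : ℕ) : ℤ) : ℚ_[p])‖ ≤ (p : ℝ) ^ (-(j : ℤ)) := by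
      calc _ = ‖((((a i : ℕ) - (b i : ℕ) : ℤ)) : ℚ_[p]) * q‖ := by
            rw [norm_mul, norm_natCast_eq_one_of_not_dvd hq, mul_one]
        _ = ‖((((a i : ℕ) : ℚ_[p]) + x i.castSucc) * q - x (Fin.last m) * y i) +
            -((((b i : ℕ) : ℚ_[p]) + x i.castSucc) * q - x (Fin.last m) * y i)‖ := by
            push_cast
            ring_nf
        _ ≤ _ := (Padic.nonarchimedean _ _).trans (max_le h1 (by rwa [norm_neg]))
    rw [Padic.norm_int_le_pow_iff_dvd] at h3
    have h4 : (b i : ℕ) ≡ (a i : ℕ) [MOD p ^ j] :=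
      (Nat.modEq_iff_dvd).2 (by push_cast; exact h3)
    exact Fin.ext (h4.eq_of_lt_of_lt (b i).2 (a i).2).symm
  have hmeas : ∀ a, MeasurableSet ((fun x => shift a + x) ⁻¹' ballCone p q j y) := fun a =>
    ((isClosed_ballCone q j y).preimage (continuous_const_add _)).measurableSet
  have hsub : (⋃ a, (fun x => shift a + x) ⁻¹' ballCone p q j y) ⊆ padicUnitPC p (m + 1) := by
    intro x hx i
    obtain ⟨a, ha⟩ := Set.mem_iUnion.1 hx
    calc ‖x i‖ = ‖(shift a + x) i + -shift a i‖ := by simp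
      _ ≤ _ := (Padic.nonarchimedean _ _).trans
        (max_le (ha.1 i) (by rw [norm_neg]; exact hshift a i))
  have hone : padicHaar p (m + 1) (padicUnitPC p (m + 1)) = 1 := Measure.addHaarMeasure_self
  calc _ = padicHaar p (m + 1) (⋃ a, (fun x => shift a + x) ⁻¹' ballCone p q j y) := by
        rw [measure_iUnion hdisj hmeas, tsum_fintype]
        simp [measure_preimage_add]
    _ ≤ _ := (measure_mono hsub).trans hone.le

end PadicBalls

/-- quasi-independence of the sets `A_{q,n}`: the measure of the overlap
`A_{q,n} ∩ A_{r,n}` is `≪ (qr p^{-j} p^{-k})^{n-1}`. -/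
theorem A_qn_overlap (n : ℕ) (hn : 2 < n) :
    ∃ C : ℝ, 0 < C ∧
      ∀ (p : ℕ) [Fact p.Prime], ∀ (q r j k : ℕ), q ≠ r → 1 ≤ q → 1 ≤ r →
        ¬ p ∣ q → ¬ p ∣ r → 1 ≤ j → 1 ≤ k →
        (p : ℝ) ^ (-(j : ℤ)) ≤ (p : ℝ) ^ (-(k : ℤ)) →
        (p : ℝ) ^ (-(j : ℤ)) ≤ 1 / (q : ℝ) → (p : ℝ) ^ (-(k : ℤ)) ≤ 1 / (r : ℝ) →
        (muP p n
          ((⋃ v ∈ {v : Fin n → ℤ | IsPrim v ∧ v ⟨n - 1, by omega⟩ = (q : ℤ) ∧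
              ∀ m, |v m| ≤ (q : ℤ)}, Bdelta p (intPadic p v) ((p : ℝ) ^ (-(j : ℤ)))) ∩
           (⋃ v ∈ {v : Fin n → ℤ | IsPrim v ∧ v ⟨n - 1, by omega⟩ = (r : ℤ) ∧
              ∀ m, |v m| ≤ (r : ℤ)}, Bdelta p (intPadic p v) ((p : ℝ) ^ (-(k : ℤ)))))).toReal ≤
          C * ((q : ℝ) * (r : ℝ) * (p : ℝ) ^ (-(j : ℤ)) * (p : ℝ) ^ (-(k : ℤ))) ^ (n - 1) := by
  obtain ⟨m, rfl⟩ : ∃ m, n = m + 1 := ⟨n - 1, by omega⟩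
  refine ⟨18 ^ m, by positivity, ?_⟩
  intro p _ q r j k hqr hq hr hpq hpr hj hk hjk _ _
  change (muP p (m + 1) ((⋃ v ∈ {v : Fin (m + 1) → ℤ | IsPrim v ∧ v (Fin.last m) = (q : ℤ) ∧
    ∀ i, |v i| ≤ (q : ℤ)}, _) ∩ (⋃ v ∈ {v : Fin (m + 1) → ℤ | IsPrim v ∧
    v (Fin.last m) = (r : ℤ) ∧ ∀ i, |v i| ≤ (r : ℤ)}, _))).toReal ≤ 18 ^ m * _ ^ m
  rw [muP]
  set X : Set (Fin (m + 1) → ℚ_[p]) := {x | _} with hX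
  set S := (Finset.Icc (-(q : ℤ)) q ×ˢ Finset.Icc (-(r : ℤ)) r).filter
    fun c => ((p ^ k : ℕ) : ℤ) ∣ c.1 * r - c.2 * q with hS
  have hp0 : 0 < p := (Fact.out : p.Prime).pos
  have hpR : (0 : ℝ) < p := by exact_mod_cast hp0
  have hmem : ∀ x ∈ X, ∃ v w : Fin (m + 1) → ℤ, (∃ i, v i * r ≠ w i * q) ∧
      (∀ i, (v i, w i) ∈ S) ∧ x ∈ ballCone p q j fun i => v i.castSucc := by
    rintro x ⟨hx1, hx, hxv, hxw⟩
    simp only [Set.mem_iUnion, Set.mem_ofPred_eq, exists_prop] at hxv hxw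
    obtain ⟨v, ⟨hvp, hvq, hvb⟩, hv⟩ := hxv
    obtain ⟨w, ⟨hwp, hwr, hwb⟩, hw⟩ := hxw
    have hv1 : ‖(v (Fin.last m) : ℚ_[p])‖ = 1 := by
      rw [hvq]
      exact_mod_cast norm_natCast_eq_one_of_not_dvd hpq
    have hw1 : ‖(w (Fin.last m) : ℚ_[p])‖ = 1 := by
      rw [hwr]
      exact_mod_cast norm_natCast_eq_one_of_not_dvd hpr
    have hv' := fun i => norm_minor_le_of_mk_mem_Bdelta hx (by positivity) hv i _ hv1
    have hw' := fun i => norm_minor_le_of_mk_mem_Bdelta hx (by positivity) hw i _ hw1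
    refine ⟨v, w, exists_mul_ne_mul_of_isPrim hvp hwp hqr, fun i => ?_, hx1, fun i => ?_⟩
    · rw [hS, Finset.mem_filter, Finset.mem_product, Finset.mem_Icc, Finset.mem_Icc]
      exact ⟨⟨abs_le.1 (hvb i), abs_le.1 (hwb i)⟩,
        dvd_of_norm_minor_le hx hj hjk hvq hwr hpq hv' hw' i⟩
    · have h := hv' i.castSucc
      rw [hvq] at h
      refine le_trans (by exact_mod_cast h) (mul_le_of_le_one_right (by positivity) ?_)
      exact (pi_norm_le_iff_of_nonneg zero_le_one).2 hx1
  rcases X.eq_empty_or_nonempty with hXe | ⟨x₀, hx₀⟩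
  · rw [hXe, measure_empty, ENNReal.toReal_zero]
    positivity
  have hcard : S.card * p ^ k ≤ 18 * (q * r) := by
    obtain ⟨v, w, ⟨i, hi⟩, hvw, -⟩ := hmem x₀ hx₀
    have h := hvw i
    rw [hS, Finset.mem_filter, Finset.mem_product, Finset.mem_Icc, Finset.mem_Icc] at h
    exact card_box_congruence_mul_le hq hr (Nat.pow_pos hp0)
      (((Fact.out : p.Prime).coprime_iff_not_dvd.2 hpq).pow_left k)
      (abs_le.2 h.1.1) (abs_le.2 h.1.2) h.2 hi
  have hcover : X ⊆ ⋃ f ∈ Fintype.piFinset (fun _ : Fin m => S),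
      ballCone p q j fun i => (f i).1 := by
    intro x hx
    obtain ⟨v, w, -, hvw, hxv⟩ := hmem x hx
    simp only [Set.mem_iUnion, exists_prop, Fintype.mem_piFinset]
    exact ⟨fun i => (v i.castSucc, w i.castSucc), fun i => hvw _, hxv⟩
  have hball : ∀ y : Fin m → ℤ, padicHaar p (m + 1) (ballCone p q j y) ≤
      ENNReal.ofReal (((p : ℝ) ^ (-(j : ℤ))) ^ m) := by
    intro y
    have h := padicHaar_ballCone_le hpq j y
    have hpos : (0 : ℝ) < ((p : ℝ) ^ j) ^ m := by positivity
    rw [zpow_neg, zpow_natCast, inv_pow, ENNReal.ofReal_inv_of_pos hpos,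
      ENNReal.ofReal_pow (by positivity), ENNReal.ofReal_pow (by positivity),
      ENNReal.ofReal_natCast, ENNReal.le_inv_iff_mul_le, mul_comm]
    exact_mod_cast h
  have hX_le : padicHaar p (m + 1) X ≤
      ENNReal.ofReal ((S.card : ℝ) ^ m * ((p : ℝ) ^ (-(j : ℤ))) ^ m) := by
    calc _ ≤ ∑ f ∈ Fintype.piFinset (fun _ : Fin m => S),
          padicHaar p (m + 1) (ballCone p q j fun i => (f i).1) :=
          (measure_mono hcover).trans (measure_biUnion_finset_le _ _)
      _ ≤ ∑ f ∈ Fintype.piFinset (fun _ : Fin m => S),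
          ENNReal.ofReal (((p : ℝ) ^ (-(j : ℤ))) ^ m) := Finset.sum_le_sum fun f _ => hball _
      _ = _ := by
          rw [Finset.sum_const, Fintype.card_piFinset_const, nsmul_eq_mul,
            ENNReal.ofReal_mul (by positivity), ← Nat.cast_pow, ENNReal.ofReal_natCast]
  refine (ENNReal.toReal_le_of_le_ofReal (by positivity) hX_le).trans ?_
  rw [← mul_pow, ← mul_pow]
  refine pow_le_pow_left₀ (by positivity) ?_ m
  have hcardR : (S.card : ℝ) ≤ 18 * (q * r) * (p : ℝ) ^ (-(k : ℤ)) := by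
    rw [zpow_neg, zpow_natCast, ← div_eq_mul_inv, le_div_iff₀ (by positivity)]
    exact_mod_cast hcard
  calc (S.card : ℝ) * (p : ℝ) ^ (-(j : ℤ))
      ≤ 18 * (q * r) * (p : ℝ) ^ (-(k : ℤ)) * (p : ℝ) ^ (-(j : ℤ)) := by gcongr
    _ = _ := by ring
end

section
/- Let n ≥ 2 and let p be a prime. There exist constants c₂ ≥ c₁ > 0, depending only on n and p, such that for every ball I = B_δ(z, p^{-m}) in ℙ^{n-1}(ℚ_p) (z ∈ ℙ^{n-1}(ℚ_p), m ≥ 0 an integer) there is T₀ = T₀(I) such that for all T ≥ T₀: c₁ · T^n · μ_p(I) ≤ #{y ∈ ℙ^{n-1}(ℚ) : y ∈ I and H(y) ≤ T} ≤ c₂ · T^n · μ_p(I). -/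
open MeasureTheory

open scoped ENNReal

theorem padic_norm_sub_le (p : ℕ) [Fact p.Prime] (x y : ℚ_[p]) : ‖x - y‖ ≤ max ‖x‖ ‖y‖ := by
  simpa [sub_eq_add_neg] using IsUltrametricDist.norm_add_le_max x (-y)

/-- Membership in a projective ball, in the affine chart of a coordinate of maximal norm. -/
theorem padicDelta_le_iff (p : ℕ) [Fact p.Prime] {n : ℕ} {x y : Fin n → ℚ_[p]} {k : Fin n}
    (hx : x ≠ 0) (hy : y ≠ 0) (hk : ‖y k‖ = ‖y‖) {r : ℝ} (hr : 0 ≤ r) :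
    padicDelta p x y ≤ r ↔ ∀ i, ‖x i - x k * (y i / y k)‖ ≤ r * ‖x‖ := by
  have hx' : 0 < ‖x‖ := norm_pos_iff.2 hx
  have hy' : 0 < ‖y‖ := norm_pos_iff.2 hy
  have hyk : y k ≠ 0 := by
    rw [← norm_pos_iff, hk]
    exact hy'
  have : Nonempty (Fin n × Fin n) := ⟨(k, k)⟩
  unfold padicDelta
  rw [div_le_iff₀ (by positivity), ciSup_le_iff (Set.finite_range _).bddAbove]
  constructor
  · intro h i
    have h1 := h (i, k)
    simp only at h1
    have h2 : x i * y k - x k * y i = (x i - x k * (y i / y k)) * y k := by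
      field_simp
    rw [h2, norm_mul, hk, ← mul_assoc] at h1
    exact le_of_mul_le_mul_right h1 hy'
  · rintro h ⟨i, j⟩
    have h2 : x i * y j - x j * y i
        = (x i - x k * (y i / y k)) * y j - (x j - x k * (y j / y k)) * y i := by
      field_simp
      ring
    simp only
    rw [h2, ← mul_assoc]
    refine (padic_norm_sub_le p _ _).trans (max_le ?_ ?_) <;> rw [norm_mul]
    · exact mul_le_mul (h i) (norm_le_pi_norm y j) (norm_nonneg _) (by positivity)
    · exact mul_le_mul (h j) (norm_le_pi_norm y i) (norm_nonneg _) (by positivity)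

theorem exists_nat_norm_sub_le (p : ℕ) [Fact p.Prime] {x : ℚ_[p]} (hx : ‖x‖ ≤ 1) (m : ℕ) :
    ∃ a : ℕ, a < p ^ m ∧ ‖x - a‖ ≤ (p : ℝ) ^ (-(m : ℤ)) := by
  obtain ⟨z, rfl⟩ : ∃ z : ℤ_[p], (z : ℚ_[p]) = x := ⟨⟨x, hx⟩, rfl⟩
  refine ⟨z.appr m, PadicInt.appr_lt _ _, ?_⟩
  have h := PadicInt.appr_spec m z
  rwa [← PadicInt.norm_le_pow_iff_mem_span_pow, PadicInt.norm_def, PadicInt.coe_sub,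
    PadicInt.coe_natCast] at h

/-- A ball of radius `p⁻ᵐ` is cut out by congruences modulo `pᵐ` with integer coefficients. -/
theorem exists_padicDelta_le_iff (p : ℕ) [Fact p.Prime] {n : ℕ} {y : Fin n → ℚ_[p]}
    (hy : y ≠ 0) (m : ℕ) :
    ∃ (k : Fin n) (ω : Fin n → ℤ), ω k = 1 ∧ ∀ x : Fin n → ℚ_[p], x ≠ 0 →
      (padicDelta p x y ≤ (p : ℝ) ^ (-(m : ℤ)) ↔
        ∀ i, ‖x i - x k * ω i‖ ≤ (p : ℝ) ^ (-(m : ℤ)) * ‖x‖) := by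
  have hne : Nonempty (Fin n) := by
    by_contra h
    rw [not_nonempty_iff] at h
    exact hy (Subsingleton.elim _ _)
  obtain ⟨k, hk⟩ : ∃ k, ‖y k‖ = ‖y‖ := by
    obtain ⟨k, hk⟩ := Finite.exists_max fun i => ‖y i‖
    exact ⟨k, le_antisymm (norm_le_pi_norm y k) ((pi_norm_le_iff_of_nonempty _).2 hk)⟩
  have hy' : 0 < ‖y‖ := norm_pos_iff.2 hy
  have hyk : y k ≠ 0 := by
    rw [← norm_pos_iff, hk]
    exact hy'
  have hw : ∀ i, ‖y i / y k‖ ≤ 1 := fun i => by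
    rw [norm_div, hk]
    exact div_le_one_of_le₀ (norm_le_pi_norm y i) hy'.le
  choose a _ ha using fun i => exists_nat_norm_sub_le p (hw i) m
  set r := (p : ℝ) ^ (-(m : ℤ)) with hr
  have hr0 : 0 ≤ r := by positivity
  refine ⟨k, fun i => if i = k then 1 else a i, if_pos rfl, fun x hx => ?_⟩
  rw [padicDelta_le_iff p hx hy hk hr0]
  refine forall_congr' fun i => ?_
  have hω : ‖x k * ((((if i = k then 1 else a i : ℤ) : ℤ) : ℚ_[p]) - y i / y k)‖ ≤ r * ‖x‖ := by
    split_ifs with h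
    · subst h
      simp only [Int.cast_one, div_self hyk, sub_self, mul_zero, norm_zero]
      positivity
    · rw [norm_mul, mul_comm]
      refine mul_le_mul ?_ (norm_le_pi_norm x k) (norm_nonneg _) hr0
      rw [norm_sub_rev]
      exact_mod_cast ha i
  constructor <;> intro h
  · have := (padic_norm_sub_le p _ _).trans (max_le h hω)
    refine le_of_eq_of_le (congrArg _ ?_) this
    ring
  · have := (IsUltrametricDist.norm_add_le_max _ _).trans (max_le h hω)
    refine le_of_eq_of_le (congrArg _ ?_) this
    ring

theorem padicHaar_translate (p : ℕ) [Fact p.Prime] (n : ℕ) (a : Fin n → ℚ_[p])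
    (A : Set (Fin n → ℚ_[p])) : padicHaar p n ((fun x => x - a) ⁻¹' A) = padicHaar p n A := by
  unfold padicHaar
  simp only [sub_eq_add_neg]
  exact measure_preimage_add_right _ _ _

theorem padicHaar_unit (p : ℕ) [Fact p.Prime] (n : ℕ) :
    padicHaar p n {x | ∀ i, ‖x i‖ ≤ 1} = 1 :=
  Measure.addHaarMeasure_self

/-- The measure of the set of integral vectors satisfying the congruences is at most the
inverse of the index. -/
theorem padicHaar_congruence_le (p : ℕ) [Fact p.Prime] (n m : ℕ) (k : Fin n) (ω : Fin n → ℤ) :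
    padicHaar p n {x | (∀ i, ‖x i‖ ≤ 1) ∧ ∀ i, ‖x i - x k * ω i‖ ≤ (p : ℝ) ^ (-(m : ℤ))}
      ≤ ((p ^ m) ^ (n - 1) : ℝ≥0∞)⁻¹ := by
  set Λ := {x : Fin n → ℚ_[p] |
    (∀ i, ‖x i‖ ≤ 1) ∧ ∀ i, ‖x i - x k * ω i‖ ≤ (p : ℝ) ^ (-(m : ℤ))} with hΛ
  have hΛm : MeasurableSet Λ := by
    refine IsClosed.measurableSet ?_
    rw [hΛ, Set.ofPred_and, Set.ofPred_forall, Set.ofPred_forall]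
    refine IsClosed.inter (isClosed_iInter fun i => ?_) (isClosed_iInter fun i => ?_) <;>
      exact isClosed_le (by fun_prop) continuous_const
  let A : Finset (Fin n → ℕ) :=
    Fintype.piFinset fun i => if i = k then {0} else Finset.range (p ^ m)
  have hA : A.card = (p ^ m) ^ (n - 1) := by
    simp only [A, Fintype.card_piFinset, apply_ite Finset.card, Finset.card_singleton,
      Finset.card_range]
    rw [Finset.prod_ite]
    simp [Finset.filter_ne']
  let c : (Fin n → ℕ) → (Fin n → ℚ_[p]) := fun a i => a i
  have hmem : ∀ a ∈ A, a k = 0 ∧ ∀ i, i ≠ k → a i < p ^ m := by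
    intro a ha
    simp only [A, Fintype.mem_piFinset] at ha
    refine ⟨by simpa using ha k, fun i hi => ?_⟩
    have := ha i
    rw [if_neg hi] at this
    simpa using this
  have hdisj : (A : Set (Fin n → ℕ)).PairwiseDisjoint fun a => (fun x => x - c a) ⁻¹' Λ := by
    intro a ha b hb hab
    refine Set.disjoint_left.2 fun x hxa hxb => hab ?_
    obtain ⟨ha0, ha1⟩ := hmem a ha
    obtain ⟨hb0, hb1⟩ := hmem b hb
    funext i
    by_cases hi : i = k
    · rw [hi, ha0, hb0]
    have h := (padic_norm_sub_le p _ _).trans (max_le (hxb.2 i) (hxa.2 i))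
    have h2 : (x - c b) i - (x - c b) k * ω i - ((x - c a) i - (x - c a) k * ω i)
        = (((a i : ℤ) - (b i : ℤ) : ℤ) : ℚ_[p]) := by
      simp [c, ha0, hb0]
    rw [h2, Padic.norm_int_le_pow_iff_dvd] at h
    have h3 : b i ≡ a i [MOD p ^ m] := by
      rw [Nat.modEq_iff_dvd]
      exact_mod_cast h
    exact (Nat.ModEq.eq_of_lt_of_lt h3 (hb1 i hi) (ha1 i hi)).symm
  have hsub : (⋃ a ∈ A, (fun x => x - c a) ⁻¹' Λ) ⊆ {x | ∀ i, ‖x i‖ ≤ 1} := by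
    intro x hx i
    simp only [Set.mem_iUnion] at hx
    obtain ⟨a, _, hx⟩ := hx
    have h1 : ‖x i - a i‖ ≤ 1 := hx.1 i
    have h2 : ‖((a i : ℤ) : ℚ_[p])‖ ≤ 1 := Padic.norm_int_le_one _
    have := (IsUltrametricDist.norm_add_le_max _ _).trans (max_le h1 h2)
    simpa using this
  have h := measure_mono (μ := padicHaar p n) hsub
  rw [measure_biUnion_finset hdisj fun a _ => (by fun_prop : Measurable fun x => x - c a) hΛm,
    padicHaar_unit, Finset.sum_congr rfl fun a _ => padicHaar_translate p n (c a) Λ,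
    Finset.sum_const, hA, nsmul_eq_mul] at h
  rw [ENNReal.le_inv_iff_mul_le, mul_comm]
  exact_mod_cast h

/-- The integral vectors satisfying the congruences whose `k`-th coordinate is a unit form a set of
measure at least `p⁻¹` times the inverse of the index. -/
theorem le_padicHaar_congruence (p : ℕ) [Fact p.Prime] (n m : ℕ) (k : Fin n) (ω : Fin n → ℤ)
    (hω : ω k = 1) :
    (p * (p ^ m) ^ (n - 1) : ℝ≥0∞)⁻¹ ≤
    padicHaar p n {x | (∀ i, ‖x i‖ ≤ 1) ∧ ‖x k‖ = 1 ∧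
      ∀ i, ‖x i - x k * ω i‖ ≤ (p : ℝ) ^ (-(m : ℤ))} := by
  set S := {x : Fin n → ℚ_[p] | (∀ i, ‖x i‖ ≤ 1) ∧ ‖x k‖ = 1 ∧
    ∀ i, ‖x i - x k * ω i‖ ≤ (p : ℝ) ^ (-(m : ℤ))} with hS
  let A : Finset (Fin n → ℕ) :=
    Fintype.piFinset fun i => if i = k then Finset.range p else Finset.range (p ^ m)
  have hA : A.card = p * (p ^ m) ^ (n - 1) := by
    simp only [A, Fintype.card_piFinset, apply_ite Finset.card, Finset.card_range]
    rw [Finset.prod_ite]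
    simp [Finset.filter_ne', Finset.filter_eq']
  let c : (Fin n → ℕ) → (Fin n → ℚ_[p]) := fun a i => a i
  have hcov : {x : Fin n → ℚ_[p] | ∀ i, ‖x i‖ ≤ 1} ⊆ ⋃ a ∈ A, (fun x => x - c a) ⁻¹' S := by
    intro x hx
    have hsub : ∀ {u v : ℚ_[p]}, ‖u‖ ≤ 1 → ‖v‖ ≤ 1 → ‖u - v‖ ≤ 1 := fun hu hv =>
      (padic_norm_sub_le p _ _).trans (max_le hu hv)
    have hnat : ∀ j : ℕ, ‖(j : ℚ_[p])‖ ≤ 1 := fun j => by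
      exact_mod_cast Padic.norm_int_le_one (p := p) (j : ℤ)
    obtain ⟨j, hj, hjx⟩ := exists_nat_norm_sub_le p (hsub (hx k) norm_one.le) 1
    have hk1 : ‖x k - j‖ = 1 := by
      have hlt : ‖x k - 1 - j‖ < ‖(1 : ℚ_[p])‖ := by
        rw [norm_one]
        refine hjx.trans_lt ?_
        have : (1 : ℝ) < p := by exact_mod_cast (Fact.out : p.Prime).one_lt
        simpa using inv_lt_one_of_one_lt₀ this
      have := Padic.add_eq_max_of_ne hlt.ne
      rw [max_eq_right hlt.le, norm_one] at this
      rw [← this]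
      congr 1
      ring
    have hb : ∀ i, ‖x i - (x k - j) * ω i‖ ≤ 1 := fun i => by
      refine hsub (hx i) ?_
      rw [norm_mul, hk1, one_mul]
      exact Padic.norm_int_le_one _
    choose b hb1 hb2 using fun i => exists_nat_norm_sub_le p (hb i) m
    simp only [Set.mem_iUnion]
    refine ⟨fun i => if i = k then j else b i, ?_, fun i => ?_, ?_, fun i => ?_⟩
    · simp only [A, Fintype.mem_piFinset]
      intro i
      split_ifs
      · simpa using hj
      · simpa using hb1 i
    · exact hsub (hx i) (hnat _)
    · simpa [c] using hk1
    · by_cases hi : i = k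
      · subst hi
        simp only [hω, Int.cast_one, mul_one, sub_self, norm_zero]
        positivity
      · have h := hb2 i
        refine le_of_eq_of_le (congrArg _ ?_) h
        simp only [Pi.sub_apply, c, if_pos, if_neg hi]
        ring
  have h := (measure_mono (μ := padicHaar p n) hcov).trans (measure_biUnion_finset_le _ _)
  rw [padicHaar_unit, Finset.sum_congr rfl fun a _ => padicHaar_translate p n (c a) S,
    Finset.sum_const, hA, nsmul_eq_mul] at h
  have hp : (p : ℝ≥0∞) ≠ 0 := by exact_mod_cast (Fact.out : p.Prime).ne_zero
  rw [ENNReal.inv_le_iff_le_mul (fun _ => mul_ne_zero hp (pow_ne_zero _ (pow_ne_zero _ hp)))]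
  · exact_mod_cast h
  · intro h0
    exact absurd h0 (by finiteness)

/-- The measure of a ball of radius `p⁻ᵐ` is comparable to `p^(-m(n-1))`. -/
theorem muP_ball_bounds (p : ℕ) [Fact p.Prime] {n : ℕ} {y : Fin n → ℚ_[p]} {m : ℕ}
    {k : Fin n} {ω : Fin n → ℤ} (hω : ω k = 1)
    (h : ∀ x : Fin n → ℚ_[p], x ≠ 0 → (padicDelta p x y ≤ (p : ℝ) ^ (-(m : ℤ)) ↔
        ∀ i, ‖x i - x k * ω i‖ ≤ (p : ℝ) ^ (-(m : ℤ)) * ‖x‖)) :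
    ((p : ℝ) * (p ^ m) ^ (n - 1))⁻¹ ≤ (muP p n (Bdelta p y ((p : ℝ) ^ (-(m : ℤ))))).toReal ∧
      (muP p n (Bdelta p y ((p : ℝ) ^ (-(m : ℤ))))).toReal ≤ (((p : ℝ) ^ m) ^ (n - 1))⁻¹ := by
  have hp : (p : ℝ≥0∞) ≠ 0 := by exact_mod_cast (Fact.out : p.Prime).ne_zero
  have hmk : ∀ (x : Fin n → ℚ_[p]) (hx : x ≠ 0),
      Projectivization.mk ℚ_[p] x hx ∈ Bdelta p y ((p : ℝ) ^ (-(m : ℤ))) ↔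
        ∀ i, ‖x i - x k * ω i‖ ≤ (p : ℝ) ^ (-(m : ℤ)) * ‖x‖ := by
    intro x hx
    obtain ⟨c, hc⟩ := Projectivization.exists_smul_eq_mk_rep ℚ_[p] x hx
    have hc0 : 0 < ‖(c : ℚ_[p])‖ := norm_pos_iff.2 c.ne_zero
    unfold Bdelta
    rw [Set.mem_ofPred_eq, h _ (Projectivization.rep_nonzero _), ← hc]
    refine forall_congr' fun i => ?_
    have h1 : (c • x) i - (c • x) k * ω i = c * (x i - x k * ω i) := by
      simp only [Pi.smul_apply, Units.smul_def, smul_eq_mul]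
      ring
    rw [h1, Units.smul_def, norm_smul, norm_mul, mul_left_comm, mul_le_mul_iff_right₀ hc0]
  have hup : muP p n (Bdelta p y ((p : ℝ) ^ (-(m : ℤ)))) ≤ ((p ^ m) ^ (n - 1) : ℝ≥0∞)⁻¹ := by
    refine (measure_mono ?_).trans (padicHaar_congruence_le p n m k ω)
    rintro x ⟨hx1, hx, hxm⟩
    refine ⟨hx1, fun i => ((hmk x hx).1 hxm i).trans ?_⟩
    refine mul_le_of_le_one_right (by positivity) ?_
    exact (pi_norm_le_iff_of_nonneg zero_le_one).2 hx1
  have hlo : (p * (p ^ m) ^ (n - 1) : ℝ≥0∞)⁻¹ ≤ muP p n (Bdelta p y ((p : ℝ) ^ (-(m : ℤ)))) := by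
    refine (le_padicHaar_congruence p n m k ω hω).trans (measure_mono ?_)
    rintro x ⟨hx1, hxk, hxm⟩
    have hx : x ≠ 0 := by
      rintro rfl
      simp at hxk
    have hn : ‖x‖ = 1 := le_antisymm ((pi_norm_le_iff_of_nonneg zero_le_one).2 hx1)
      (hxk ▸ norm_le_pi_norm x k)
    refine ⟨hx1, hx, (hmk x hx).2 fun i => ?_⟩
    rw [hn, mul_one]
    exact hxm i
  have hfin : ((p ^ m) ^ (n - 1) : ℝ≥0∞)⁻¹ ≠ ⊤ :=
    ENNReal.inv_ne_top.2 (pow_ne_zero _ (pow_ne_zero _ hp))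
  constructor
  · have := ENNReal.toReal_mono (ne_top_of_le_ne_top hfin hup) hlo
    simpa using this
  · have := ENNReal.toReal_mono hfin hup
    simpa using this

theorem sum_Icc_inv_sq_le (T : ℕ) : ∑ d ∈ Finset.Icc 2 T, ((d : ℝ) ^ 2)⁻¹ ≤ 3 / 4 := by
  rcases lt_or_ge T 2 with hT | hT
  · rw [Finset.Icc_eq_empty (by omega), Finset.sum_empty]
    norm_num
  · suffices h : ∑ d ∈ Finset.Icc 2 T, ((d : ℝ) ^ 2)⁻¹ ≤ 3 / 4 - (T : ℝ)⁻¹ by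
      have : 0 ≤ (T : ℝ)⁻¹ := by positivity
      linarith
    induction T, hT using Nat.le_induction with
    | base => norm_num
    | succ T hT ih =>
      rw [Finset.sum_Icc_succ_top (by omega)]
      have h0 : (0 : ℝ) < T := by exact_mod_cast (by omega : 0 < T)
      have : (((T + 1 : ℕ) : ℝ) ^ 2)⁻¹ ≤ (T : ℝ)⁻¹ - ((T + 1 : ℕ) : ℝ)⁻¹ := by
        push_cast
        rw [inv_sub_inv (by positivity) (by positivity), inv_eq_one_div,
          div_le_div_iff₀ (by positivity) (by positivity)]
        nlinarith
      linarith

theorem sum_Icc_inv_le_one_add_log (T : ℕ) :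
    ∑ d ∈ Finset.Icc 2 T, (d : ℝ)⁻¹ ≤ 1 + Real.log T := by
  refine le_trans ?_ (harmonic_le_one_add_log T)
  rw [harmonic_eq_sum_Icc]
  push_cast
  exact Finset.sum_le_sum_of_subset_of_nonneg (Finset.Icc_subset_Icc_left one_le_two)
    fun _ _ _ => by positivity

/-- The index pairs of a box at which the pair `(1 + p s, r s + q t)` is coprime. -/
def coprimePairs (p q : ℕ) (r : ℕ → ℕ) (S R : ℕ) : Finset (ℕ × ℕ) :=
  (Finset.range S ×ˢ Finset.range R).filter fun u =>
    Nat.Coprime (1 + p * u.1) (r u.1 + q * u.2)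

theorem card_common_divisor_le {p q d : ℕ} (hpq : ∀ d, Nat.Coprime d p → Nat.Coprime d q)
    (r : ℕ → ℕ) (S R : ℕ) :
    ((Finset.range S ×ˢ Finset.range R).filter fun u =>
      d ∣ 1 + p * u.1 ∧ d ∣ r u.1 + q * u.2).card ≤ (S / d + 1) * (R / d + 1) := by
  have hcard : (Finset.range (S / d + 1) ×ˢ Finset.range (R / d + 1)).card
      = (S / d + 1) * (R / d + 1) := by simp
  rw [← hcard]
  refine Finset.card_le_card_of_injOn (fun u => (u.1 / d, u.2 / d)) ?_ ?_
  · intro u hu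
    simp only [Finset.coe_filter, Finset.mem_product, Finset.mem_range, Set.mem_ofPred_eq] at hu
    simp only [Finset.coe_product, Finset.coe_range, Set.mem_prod, Set.mem_Iio]
    exact ⟨Nat.lt_succ_of_le (Nat.div_le_div_right hu.1.1.le),
      Nat.lt_succ_of_le (Nat.div_le_div_right hu.1.2.le)⟩
  · rintro ⟨s, t⟩ hu ⟨s', t'⟩ hu' heq
    simp only [Finset.coe_filter, Finset.mem_product, Finset.mem_range, Set.mem_ofPred_eq] at hu hu'
    simp only [Prod.mk.injEq] at heq
    have hdp : Nat.Coprime d p := by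
      refine Nat.Coprime.coprime_dvd_left hu.2.1 ?_
      simp
    have hs : s = s' := by
      have h1 : 1 + p * s ≡ 1 + p * s' [MOD d] :=
        ((Nat.modEq_zero_iff_dvd).2 hu.2.1).trans ((Nat.modEq_zero_iff_dvd).2 hu'.2.1).symm
      have h2 : s ≡ s' [MOD d] :=
        Nat.ModEq.cancel_left_of_coprime hdp (Nat.ModEq.add_left_cancel' 1 h1)
      rw [← Nat.div_add_mod s d, ← Nat.div_add_mod s' d, heq.1, h2]
    subst hs
    have ht : t = t' := by
      have h1 : r s + q * t ≡ r s + q * t' [MOD d] :=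
        ((Nat.modEq_zero_iff_dvd).2 hu.2.2).trans ((Nat.modEq_zero_iff_dvd).2 hu'.2.2).symm
      have h2 : t ≡ t' [MOD d] :=
        Nat.ModEq.cancel_left_of_coprime (hpq d hdp) (Nat.ModEq.add_left_cancel' _ h1)
      rw [← Nat.div_add_mod t d, ← Nat.div_add_mod t' d, heq.2, h2]
    rw [ht]

theorem le_card_coprimePairs {p q : ℕ} (hp : 0 < p)
    (hpq : ∀ d, Nat.Coprime d p → Nat.Coprime d q) (r : ℕ → ℕ) {S R T : ℕ} (hT : p * S ≤ T) :
    (S * R : ℝ) / 4 - ((S + R) * (1 + Real.log T) + T) ≤ (coprimePairs p q r S R).card := by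
  set B := (Finset.range S ×ˢ Finset.range R).filter fun u : ℕ × ℕ =>
    ¬ Nat.Coprime (1 + p * u.1) (r u.1 + q * u.2) with hB
  have hsum : (coprimePairs p q r S R).card + B.card = S * R := by
    have h := Finset.card_filter_add_card_filter_not (s := Finset.range S ×ˢ Finset.range R)
      fun u : ℕ × ℕ => Nat.Coprime (1 + p * u.1) (r u.1 + q * u.2)
    rw [Finset.card_product, Finset.card_range, Finset.card_range] at h
    exact h
  have hBsub : B ⊆ (Finset.Icc 2 T).biUnion fun d =>
      (Finset.range S ×ˢ Finset.range R).filter fun u =>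
        d ∣ 1 + p * u.1 ∧ d ∣ r u.1 + q * u.2 := by
    intro u hu
    rw [hB, Finset.mem_filter, Finset.mem_product, Finset.mem_range, Finset.mem_range] at hu
    simp only [Finset.mem_biUnion, Finset.mem_Icc, Finset.mem_filter, Finset.mem_product,
      Finset.mem_range]
    have hd := Nat.gcd_dvd_left (1 + p * u.1) (r u.1 + q * u.2)
    refine ⟨Nat.gcd (1 + p * u.1) (r u.1 + q * u.2), ⟨?_, ?_⟩, hu.1, hd, Nat.gcd_dvd_right _ _⟩
    · have h0 : 0 < Nat.gcd (1 + p * u.1) (r u.1 + q * u.2) :=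
        Nat.gcd_pos_of_pos_left _ (by omega)
      have h1 : Nat.gcd (1 + p * u.1) (r u.1 + q * u.2) ≠ 1 := hu.2
      omega
    · refine (Nat.le_of_dvd (by omega) hd).trans (le_trans ?_ hT)
      calc 1 + p * u.1 ≤ p + p * u.1 := by omega
        _ = p * (u.1 + 1) := by ring
        _ ≤ p * S := Nat.mul_le_mul_left _ hu.1.1
  have hBcard : (B.card : ℝ) ≤ ∑ d ∈ Finset.Icc 2 T, ((S : ℝ) / d + 1) * ((R : ℝ) / d + 1) := by
    have h := (Finset.card_le_card hBsub).trans (Finset.card_biUnion_le.trans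
      (Finset.sum_le_sum fun d _ => card_common_divisor_le hpq r S R))
    refine (Nat.cast_le.2 h).trans ?_
    push_cast
    refine Finset.sum_le_sum fun d _ => ?_
    gcongr <;> exact Nat.cast_div_le
  have hexp : ∑ d ∈ Finset.Icc 2 T, ((S : ℝ) / d + 1) * ((R : ℝ) / d + 1)
      = (S * R) * ∑ d ∈ Finset.Icc 2 T, ((d : ℝ) ^ 2)⁻¹
        + (S + R) * ∑ d ∈ Finset.Icc 2 T, (d : ℝ)⁻¹ + ((Finset.Icc 2 T).card : ℝ) := by
    rw [Finset.mul_sum, Finset.mul_sum, Finset.cast_card, ← Finset.sum_add_distrib,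
      ← Finset.sum_add_distrib]
    refine Finset.sum_congr rfl fun d _ => ?_
    rw [div_eq_mul_inv, div_eq_mul_inv, ← inv_pow]
    ring
  have h1 : (S * R : ℝ) * ∑ d ∈ Finset.Icc 2 T, ((d : ℝ) ^ 2)⁻¹ ≤ (S * R) * (3 / 4) :=
    mul_le_mul_of_nonneg_left (sum_Icc_inv_sq_le T) (by positivity)
  have h2 : (S + R : ℝ) * ∑ d ∈ Finset.Icc 2 T, (d : ℝ)⁻¹ ≤ (S + R) * (1 + Real.log T) :=
    mul_le_mul_of_nonneg_left (sum_Icc_inv_le_one_add_log T) (by positivity)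
  have h3 : ((Finset.Icc 2 T).card : ℝ) ≤ T := by
    rw [Nat.card_Icc]
    exact_mod_cast (by omega : T + 1 - 2 ≤ T)
  have h4 : ((coprimePairs p q r S R).card : ℝ) + B.card = S * R := by exact_mod_cast hsum
  linarith

theorem half_div_le_cast_div {q T : ℕ} (hq : 0 < q) (hT : q ≤ T) :
    (T : ℝ) / (2 * q) ≤ ((T / q : ℕ) : ℝ) := by
  have h1 : T < q * (T / q + 1) := Nat.lt_mul_div_succ T hq
  have h2 : 1 ≤ T / q := (Nat.one_le_div_iff hq).2 hT
  rw [div_le_iff₀ (by positivity)]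
  have : T ≤ T / q * (2 * q) := by nlinarith
  exact_mod_cast this

/-- A positive proportion of the index pairs is coprime once the box is large, uniformly in the
residues `r`. -/
theorem exists_forall_le_card_coprimePairs {p q : ℕ} (hp : 0 < p) (hq : 0 < q)
    (hpq : ∀ d, Nat.Coprime d p → Nat.Coprime d q) :
    ∃ T₀ : ℕ, ∀ T, T₀ ≤ T → ∀ r : ℕ → ℕ,
      (T : ℝ) ^ 2 / (32 * p * q) ≤ (coprimePairs p q r (T / p) (T / q)).card := by
  have hc : (0 : ℝ) < 1 / (128 * p * q) := by positivity
  have hlog := (Real.isLittleO_log_id_atTop.bound hc).and (Filter.eventually_ge_atTop (0 : ℝ))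
  obtain ⟨T₁, hT₁⟩ := Filter.eventually_atTop.1 (tendsto_natCast_atTop_atTop.eventually hlog)
  refine ⟨max T₁ (max (192 * p * q) (max p q)), fun T hT r => ?_⟩
  simp only [max_le_iff] at hT
  obtain ⟨hT1, hT2, hTp, hTq⟩ := hT
  have hT0 : (0 : ℝ) < T := by exact_mod_cast (by omega : 0 < T)
  have hlogT : Real.log T ≤ 1 / (128 * p * q) * T := by
    refine (le_abs_self _).trans ?_
    simpa using (hT₁ T hT1).1
  have hS : ((T / p : ℕ) : ℝ) ≤ T := by exact_mod_cast Nat.div_le_self T p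
  have hR : ((T / q : ℕ) : ℝ) ≤ T := by exact_mod_cast Nat.div_le_self T q
  have hlog0 : 0 ≤ Real.log T := Real.log_natCast_nonneg T
  refine le_trans ?_ (le_card_coprimePairs hp hpq r (Nat.mul_div_le T p))
  have hSR : (T : ℝ) ^ 2 / (4 * p * q) ≤ ((T / p : ℕ) : ℝ) * ((T / q : ℕ) : ℝ) := by
    refine le_trans (le_of_eq ?_) (mul_le_mul (half_div_le_cast_div hp hTp)
      (half_div_le_cast_div hq hTq) (by positivity) (by positivity))
    field_simp
    norm_num
  have h3 : (3 : ℝ) ≤ 1 / (64 * p * q) * T := by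
    rw [one_div_mul_eq_div, le_div_iff₀ (by positivity)]
    have : 3 * (64 * p * q) ≤ T := by nlinarith
    exact_mod_cast this
  have herr : (((T / p : ℕ) : ℝ) + ((T / q : ℕ) : ℝ)) * (1 + Real.log T) + T
      ≤ (T : ℝ) ^ 2 / (32 * p * q) := by
    calc (((T / p : ℕ) : ℝ) + ((T / q : ℕ) : ℝ)) * (1 + Real.log T) + T
        ≤ (T + T) * (1 + Real.log T) + T := by gcongr
      _ = (3 + 2 * Real.log T) * T := by ring
      _ ≤ (1 / (64 * p * q) * T + 2 * (1 / (128 * p * q) * T)) * T := by gcongr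
      _ = (T : ℝ) ^ 2 / (32 * p * q) := by
        field_simp
        norm_num
  have : (T : ℝ) ^ 2 / (4 * p * q) / 4 = 2 * ((T : ℝ) ^ 2 / (32 * p * q)) := by
    field_simp
    norm_num
  linarith

/-- The integer vectors in a box satisfying the congruences of a projective ball. -/
noncomputable def congruenceVectors {n : ℕ} (q : ℕ) (k : Fin n) (ω : Fin n → ℤ) (T : ℕ) :
    Finset (Fin n → ℤ) :=
  (Fintype.piFinset fun _ => Finset.Icc (-(T : ℤ)) T).filter fun v =>
    ∀ i, (q : ℤ) ∣ v i - v k * ω i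

theorem card_congruenceVectors_le {n : ℕ} {q : ℕ} (hq : 0 < q) (k : Fin n) (ω : Fin n → ℤ)
    (T : ℕ) :
    (congruenceVectors q k ω T).card ≤ (2 * T + 1) * (2 * T / q + 1) ^ (n - 1) := by
  have hq' : (0 : ℤ) < q := by exact_mod_cast hq
  let A : Finset (Fin n → ℤ) := Fintype.piFinset fun i =>
    if i = k then Finset.Icc (-(T : ℤ)) T else Finset.Icc 0 ((2 * T / q : ℕ) : ℤ)
  have hA : A.card = (2 * T + 1) * (2 * T / q + 1) ^ (n - 1) := by
    simp only [A, Fintype.card_piFinset, apply_ite Finset.card]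
    rw [Finset.prod_ite]
    simp only [Int.card_Icc, Finset.filter_ne', Finset.filter_eq', Finset.prod_const,
      Finset.mem_univ, if_true, Finset.card_singleton, pow_one, Finset.card_erase_of_mem,
      Finset.card_univ, Fintype.card_fin]
    congr 1
    omega
  rw [← hA]
  refine Finset.card_le_card_of_injOn
    (fun v i => if i = k then v k else (v i + T) / q) ?_ ?_
  · intro v hv
    simp only [congruenceVectors, Finset.coe_filter, Fintype.mem_piFinset, Finset.mem_Icc,
      Set.mem_ofPred_eq] at hv
    simp only [A, Fintype.coe_piFinset, Set.mem_pi, Set.mem_univ, true_implies]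
    intro i
    have hi := hv.1 i
    split_ifs with h
    · simpa using hv.1 k
    · simp only [Finset.coe_Icc, Set.mem_Icc]
      refine ⟨Int.ediv_nonneg (by omega) hq'.le, ?_⟩
      push_cast
      exact Int.ediv_le_ediv hq' (by omega)
  · intro v hv v' hv' heq
    simp only [congruenceVectors, Finset.coe_filter, Fintype.mem_piFinset, Finset.mem_Icc,
      Set.mem_ofPred_eq] at hv hv'
    have hk : v k = v' k := by simpa using congrFun heq k
    funext i
    by_cases hi : i = k
    · rw [hi, hk]
    have h1 : (v i + T) / q = (v' i + T) / q := by simpa [hi] using congrFun heq i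
    have h2 : (q : ℤ) ∣ (v i + T) - (v' i + T) := by
      have := dvd_sub (hv.2 i) (hv'.2 i)
      rw [hk] at this
      have h3 : v i + T - (v' i + T) = v i - v' k * ω i - (v' i - v' k * ω i) := by ring
      rwa [h3]
    have h4 : (v i + T) % q = (v' i + T) % q := Int.ModEq.symm ((Int.modEq_iff_dvd).2 h2)
    have h5 := Int.mul_ediv_add_emod (v i + T) q
    rw [h1, h4, Int.mul_ediv_add_emod] at h5
    omega

theorem exists_primitive_congruenceVectors {n : ℕ} {p q : ℕ} (hp : 0 < p) (hq : 0 < q)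
    {k j : Fin n} (hjk : j ≠ k) {ω : Fin n → ℤ} (hω : ω k = 1) (T : ℕ) :
    ∃ W ⊆ congruenceVectors q k ω T, (∀ v ∈ W, IsPrim v ∧ 0 < v k) ∧
      (coprimePairs p q (fun s => ((1 + p * s) * ω j % q).toNat) (T / p) (T / q)).card
        * (T / q) ^ (n - 2) ≤ W.card := by
  have hq' : (0 : ℤ) < q := by exact_mod_cast hq
  set G := coprimePairs p q (fun s => ((1 + p * s) * ω j % q).toNat) (T / p) (T / q) with hG
  let I := {i : Fin n // i ≠ k ∧ i ≠ j}
  have hI : Fintype.card I = n - 2 := by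
    rw [Fintype.card_subtype]
    have : (Finset.univ.filter fun i : Fin n => i ≠ k ∧ i ≠ j)
        = (Finset.univ.erase k).erase j := by
      ext i
      simp [and_comm]
    rw [this, Finset.card_erase_of_mem (by simp [hjk]), Finset.card_erase_of_mem (by simp)]
    simp
    omega
  let E : Finset ((ℕ × ℕ) × (I → ℕ)) :=
    G ×ˢ Fintype.piFinset fun _ => Finset.range (T / q)
  have hE : E.card = G.card * (T / q) ^ (n - 2) := by
    simp [E, Finset.card_product, hI]
  let c : (ℕ × ℕ) × (I → ℕ) → Fin n → ℕ := fun e i =>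
    if h : i ≠ k ∧ i ≠ j then e.2 ⟨i, h⟩ else e.1.2
  let f : (ℕ × ℕ) × (I → ℕ) → Fin n → ℤ := fun e i =>
    if i = k then 1 + p * e.1.1 else (1 + p * e.1.1) * ω i % q + q * c e i
  have hfk : ∀ e, f e k = 1 + p * e.1.1 := fun e => if_pos rfl
  have hfi : ∀ e i, i ≠ k → f e i = (1 + p * e.1.1) * ω i % q + q * c e i :=
    fun e i hi => if_neg hi
  have hcj : ∀ e, c e j = e.1.2 := fun e => by simp [c]
  have hEmem : ∀ e ∈ E, e.1.1 < T / p ∧ (∀ i, c e i < T / q) ∧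
      Nat.Coprime (1 + p * e.1.1) (((1 + p * e.1.1) * ω j % q).toNat + q * e.1.2) := by
    intro e he
    simp only [E, hG, coprimePairs, Finset.mem_product, Finset.mem_filter, Finset.mem_range,
      Fintype.mem_piFinset] at he
    refine ⟨he.1.1.1, fun i => ?_, he.1.2⟩
    simp only [c]
    split_ifs with h
    · exact he.2 _
    · exact he.1.1.2
  have hinj : Set.InjOn f E := by
    rintro ⟨⟨s, t⟩, w⟩ _ ⟨⟨s', t'⟩, w'⟩ _ heq
    have hs : s = s' := by
      have h := congrFun heq k
      rw [hfk, hfk] at h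
      have hp' : (p : ℤ) ≠ 0 := by exact_mod_cast hp.ne'
      exact_mod_cast mul_left_cancel₀ hp' (add_left_cancel h)
    subst hs
    have hc : ∀ i, i ≠ k → c ((s, t), w) i = c ((s, t'), w') i := by
      intro i hi
      have h := congrFun heq i
      rw [hfi _ _ hi, hfi _ _ hi] at h
      exact_mod_cast mul_left_cancel₀ hq'.ne' (add_left_cancel h)
    have ht : t = t' := by simpa [hcj] using hc j hjk
    have hw : w = w' := by
      funext i
      simpa [c, i.2.1, i.2.2] using hc i i.2.1
    rw [ht, hw]
  refine ⟨E.image f, ?_, ?_, ?_⟩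
  · intro v hv
    obtain ⟨e, he, rfl⟩ := Finset.mem_image.1 hv
    obtain ⟨hs, hc, -⟩ := hEmem e he
    simp only [congruenceVectors, Finset.mem_filter, Fintype.mem_piFinset, Finset.mem_Icc]
    refine ⟨fun i => ?_, fun i => ?_⟩
    · by_cases hi : i = k
      · subst hi
        rw [hfk]
        have h1 : p * (e.1.1 + 1) ≤ T := (Nat.mul_le_mul_left p hs).trans (Nat.mul_div_le T p)
        have h2 : 1 + p * e.1.1 ≤ T := by
          rw [mul_add] at h1
          omega
        constructor
        · have : (0 : ℤ) ≤ 1 + p * e.1.1 := by positivity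
          omega
        · exact_mod_cast h2
      · rw [hfi e i hi]
        have h1 : q * (c e i + 1) ≤ T := (Nat.mul_le_mul_left q (hc i)).trans (Nat.mul_div_le T q)
        have h1' : (q : ℤ) * (c e i + 1) ≤ T := by exact_mod_cast h1
        have h2 := Int.emod_nonneg ((1 + p * e.1.1 : ℤ) * ω i) hq'.ne'
        have h3 := Int.emod_lt_of_pos ((1 + p * e.1.1 : ℤ) * ω i) hq'
        have h4 : (0 : ℤ) ≤ q * c e i := by positivity
        constructor <;> linarith
    · by_cases hi : i = k
      · subst hi
        simp [hω]
      · rw [hfk, hfi e i hi]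
        refine ⟨c e i - (1 + p * e.1.1) * ω i / q, ?_⟩
        have := Int.mul_ediv_add_emod ((1 + p * e.1.1 : ℤ) * ω i) q
        linarith
  · intro v hv
    obtain ⟨e, he, rfl⟩ := Finset.mem_image.1 hv
    obtain ⟨-, -, hcop⟩ := hEmem e he
    refine ⟨?_, ?_⟩
    · have h1 : Finset.univ.gcd (f e) ∣ f e k := Finset.gcd_dvd (Finset.mem_univ k)
      have h2 : Finset.univ.gcd (f e) ∣ f e j := Finset.gcd_dvd (Finset.mem_univ j)
      have hj : f e j = ((((1 + p * e.1.1) * ω j % q).toNat + q * e.1.2 : ℕ) : ℤ) := by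
        rw [hfi e j hjk, hcj]
        push_cast
        rw [Int.toNat_of_nonneg (Int.emod_nonneg _ hq'.ne')]
      have hk : f e k = ((1 + p * e.1.1 : ℕ) : ℤ) := by
        rw [hfk]
        push_cast
        rfl
      have hu : IsUnit (Finset.univ.gcd (f e)) := by
        refine IsCoprime.isUnit_of_dvd' (a := f e k) (b := f e j) ?_ h1 h2
        rw [hj, hk]
        exact Nat.isCoprime_iff_coprime.2 hcop
      unfold IsPrim
      rw [← Finset.normalize_gcd]
      exact normalize_eq_one.2 hu
    · rw [hfk]
      positivity
  · rw [Finset.card_image_of_injOn hinj, hE]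

theorem IsPrim.norm_intPadic (p : ℕ) [Fact p.Prime] {n : ℕ} {v : Fin n → ℤ} (hv : IsPrim v) :
    ‖intPadic p v‖ = 1 := by
  have hle : ‖intPadic p v‖ ≤ 1 :=
    (pi_norm_le_iff_of_nonneg zero_le_one).2 fun i => Padic.norm_int_le_one _
  refine hle.antisymm (not_lt.1 fun hlt => ?_)
  have hdvd : (p : ℤ) ∣ Finset.univ.gcd v := Finset.dvd_gcd fun i _ =>
    (Padic.norm_intCast_lt_one_iff).1 ((norm_le_pi_norm (intPadic p v) i).trans_lt hlt)
  rw [hv] at hdvd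
  exact (Nat.prime_iff_prime_int.1 (Fact.out : p.Prime)).not_dvd_one hdvd

theorem IsPrim.padicDelta_le_iff (p : ℕ) [Fact p.Prime] {n : ℕ} {y : Fin n → ℚ_[p]} {m : ℕ}
    {k : Fin n} {ω : Fin n → ℤ}
    (h : ∀ x : Fin n → ℚ_[p], x ≠ 0 → (padicDelta p x y ≤ (p : ℝ) ^ (-(m : ℤ)) ↔
        ∀ i, ‖x i - x k * ω i‖ ≤ (p : ℝ) ^ (-(m : ℤ)) * ‖x‖))
    {v : Fin n → ℤ} (hv : IsPrim v) :
    padicDelta p (intPadic p v) y ≤ (p : ℝ) ^ (-(m : ℤ)) ↔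
      ∀ i, ((p ^ m : ℕ) : ℤ) ∣ v i - v k * ω i := by
  have hn := hv.norm_intPadic p
  have h0 : intPadic p v ≠ 0 := by
    rw [← norm_pos_iff, hn]
    exact one_pos
  rw [h _ h0, hn]
  refine forall_congr' fun i => ?_
  rw [Nat.cast_pow, mul_one, ← Padic.norm_int_le_pow_iff_dvd]
  simp [intPadic]

theorem IsPrim.intRat_ne_zero {n : ℕ} {v : Fin n → ℤ} (hv : IsPrim v) : intRat v ≠ 0 := by
  intro h
  have h0 : ∀ i, v i = 0 := fun i => by simpa [intRat] using congrFun h i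
  have : (Finset.univ : Finset (Fin n)).gcd v = 0 := Finset.gcd_eq_zero_iff.2 fun i _ => h0 i
  rw [hv] at this
  exact one_ne_zero this

/-- Primitive vectors with a positive common coordinate are determined by the line they span. -/
theorem IsPrim.eq_of_mk_eq {n : ℕ} {v w : Fin n → ℤ} (hv : IsPrim v) (hw : IsPrim w) {k : Fin n}
    (hvk : 0 < v k) (hwk : 0 < w k)
    (h : Projectivization.mk ℚ (intRat v) hv.intRat_ne_zero
      = Projectivization.mk ℚ (intRat w) hw.intRat_ne_zero) : v = w := by
  obtain ⟨c, hc⟩ := (Projectivization.mk_eq_mk_iff' ℚ _ _ _ _).1 h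
  have hcross : ∀ i, w k * v i = v k * w i := by
    intro i
    have hi : c * w i = v i := congrFun hc i
    have hk : c * w k = v k := congrFun hc k
    have : (w k : ℚ) * v i = v k * w i := by
      rw [← hi, ← hk]
      ring
    exact_mod_cast this
  have hkk : w k = v k := by
    have h1 : (Finset.univ : Finset (Fin n)).gcd (fun i => w k * v i)
        = Finset.univ.gcd (fun i => v k * w i) := Finset.gcd_congr rfl fun i _ => hcross i
    rw [Finset.gcd_mul_left, Finset.gcd_mul_left] at h1
    unfold IsPrim at hv hw
    rwa [hv, hw, mul_one, mul_one, Int.normalize_of_nonneg hvk.le,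
      Int.normalize_of_nonneg hwk.le] at h1
  funext i
  have := hcross i
  rw [hkk] at this
  exact mul_left_cancel₀ hvk.ne' this

theorem Hsup_le_iff {n : ℕ} (v : Fin n → ℤ) (T : ℕ) :
    Hsup v ≤ T ↔ ∀ i, v i ∈ Finset.Icc (-(T : ℤ)) T := by
  unfold Hsup
  rw [Finset.sup_le_iff]
  refine ⟨fun h i => ?_, fun h i _ => ?_⟩
  · have := h i (Finset.mem_univ i)
    rw [Finset.mem_Icc]
    omega
  · have := h i
    rw [Finset.mem_Icc] at this
    omega

open Classical in
/-- Counting rational points in a ball amounts to counting primitive congruence vectors. -/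
theorem ncard_points_bounds (p : ℕ) [Fact p.Prime] {n : ℕ} {y : Fin n → ℚ_[p]} {m : ℕ}
    {k : Fin n} {ω : Fin n → ℤ}
    (h : ∀ x : Fin n → ℚ_[p], x ≠ 0 → (padicDelta p x y ≤ (p : ℝ) ^ (-(m : ℤ)) ↔
        ∀ i, ‖x i - x k * ω i‖ ≤ (p : ℝ) ^ (-(m : ℤ)) * ‖x‖)) (T : ℕ)
    {W : Finset (Fin n → ℤ)} (hW : W ⊆ congruenceVectors (p ^ m) k ω T)
    (hW' : ∀ v ∈ W, IsPrim v ∧ 0 < v k) :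
    W.card ≤ {y' : Projectivization ℚ (Fin n → ℚ) | ∃ v : Fin n → ℤ, IsPrim v ∧
        (∃ hv : intRat v ≠ 0, y' = Projectivization.mk ℚ (intRat v) hv) ∧
        padicDelta p (intPadic p v) y ≤ (p : ℝ) ^ (-(m : ℤ)) ∧ Hsup v ≤ T}.ncard ∧
      {y' : Projectivization ℚ (Fin n → ℚ) | ∃ v : Fin n → ℤ, IsPrim v ∧
        (∃ hv : intRat v ≠ 0, y' = Projectivization.mk ℚ (intRat v) hv) ∧
        padicDelta p (intPadic p v) y ≤ (p : ℝ) ^ (-(m : ℤ)) ∧ Hsup v ≤ T}.ncard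
      ≤ (congruenceVectors (p ^ m) k ω T).card := by
  set C := {y' : Projectivization ℚ (Fin n → ℚ) | ∃ v : Fin n → ℤ, IsPrim v ∧
        (∃ hv : intRat v ≠ 0, y' = Projectivization.mk ℚ (intRat v) hv) ∧
        padicDelta p (intPadic p v) y ≤ (p : ℝ) ^ (-(m : ℤ)) ∧ Hsup v ≤ T} with hC
  have hone : (fun _ => 1 : Fin n → ℚ) ≠ 0 := fun h0 => one_ne_zero (congrFun h0 k)
  let g : (Fin n → ℤ) → Projectivization ℚ (Fin n → ℚ) := fun v =>
    if hv : intRat v ≠ 0 then Projectivization.mk ℚ (intRat v) hv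
    else Projectivization.mk ℚ _ hone
  have hg : ∀ v (hv : intRat v ≠ 0), g v = Projectivization.mk ℚ (intRat v) hv :=
    fun v hv => dif_pos hv
  have hCsub : C ⊆ g '' (congruenceVectors (p ^ m) k ω T : Set (Fin n → ℤ)) := by
    rintro _ ⟨v, hv, ⟨hv0, rfl⟩, hd, hT⟩
    refine ⟨v, ?_, hg v hv0⟩
    simp only [congruenceVectors, Finset.coe_filter, Fintype.mem_piFinset, Set.mem_ofPred_eq]
    exact ⟨(Hsup_le_iff v T).1 hT, (hv.padicDelta_le_iff p h).1 hd⟩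
  have hfin : (g '' (congruenceVectors (p ^ m) k ω T : Set (Fin n → ℤ))).Finite :=
    (Finset.finite_toSet _).image g
  constructor
  · have hinj : Set.InjOn g W := by
      intro v hv w hw hvw
      obtain ⟨hv1, hv2⟩ := hW' v hv
      obtain ⟨hw1, hw2⟩ := hW' w hw
      rw [hg v hv1.intRat_ne_zero, hg w hw1.intRat_ne_zero] at hvw
      exact hv1.eq_of_mk_eq hw1 hv2 hw2 hvw
    rw [← Set.ncard_coe_finset W, ← hinj.ncard_image]
    refine Set.ncard_le_ncard ?_ (hfin.subset hCsub)
    rintro _ ⟨v, hv, rfl⟩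
    have hv1 := (hW' v hv).1
    have hmem := hW hv
    simp only [congruenceVectors, Finset.mem_filter, Fintype.mem_piFinset] at hmem
    exact ⟨v, hv1, ⟨hv1.intRat_ne_zero, hg v hv1.intRat_ne_zero⟩,
      (hv1.padicDelta_le_iff p h).2 hmem.2, (Hsup_le_iff v T).2 hmem.1⟩
  · refine (Set.ncard_le_ncard hCsub hfin).trans
      ((Set.ncard_image_le (Finset.finite_toSet _)).trans ?_)
    rw [Set.ncard_coe_finset]

/-- the Schanuel–Choi counting estimate: the number of rational projective
points of height at most `T` in a ball `I` of `ℙ^{n-1}(ℚ_p)` is `≍ T^n μ_p(I)`. -/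
theorem rational_point_count_in_balls (n p : ℕ) (hn : 2 ≤ n) [Fact p.Prime] :
    ∃ c₁ c₂ : ℝ, 0 < c₁ ∧ c₁ ≤ c₂ ∧
      ∀ (z : Projectivization ℚ_[p] (Fin n → ℚ_[p])) (m : ℕ), ∃ T₀ : ℕ, ∀ T : ℕ, T₀ ≤ T →
        c₁ * (T : ℝ) ^ n * (muP p n (Bdelta p z.rep ((p : ℝ) ^ (-(m : ℤ))))).toReal ≤
          ({y : Projectivization ℚ (Fin n → ℚ) | ∃ v : Fin n → ℤ, IsPrim v ∧
            (∃ hv : intRat v ≠ 0, y = Projectivization.mk ℚ (intRat v) hv) ∧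
            padicDelta p (intPadic p v) z.rep ≤ (p : ℝ) ^ (-(m : ℤ)) ∧
            Hsup v ≤ T}.ncard : ℝ) ∧
        ({y : Projectivization ℚ (Fin n → ℚ) | ∃ v : Fin n → ℤ, IsPrim v ∧
            (∃ hv : intRat v ≠ 0, y = Projectivization.mk ℚ (intRat v) hv) ∧
            padicDelta p (intPadic p v) z.rep ≤ (p : ℝ) ^ (-(m : ℤ)) ∧
            Hsup v ≤ T}.ncard : ℝ) ≤
          c₂ * (T : ℝ) ^ n * (muP p n (Bdelta p z.rep ((p : ℝ) ^ (-(m : ℤ))))).toReal := by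
  have hp := (Fact.out : p.Prime)
  have hp0 : (0 : ℝ) < p := by exact_mod_cast hp.pos
  refine ⟨1 / (32 * p * 2 ^ (n - 2)), 3 ^ n * p, by positivity, ?_, fun z m => ?_⟩
  · have hp1 : (1 : ℝ) ≤ p := by exact_mod_cast hp.one_le
    have h1 : (1 : ℝ) / (32 * p * 2 ^ (n - 2)) ≤ 1 := by
      refine div_le_one_of_le₀ ?_ (by positivity)
      have : (1 : ℝ) ≤ 2 ^ (n - 2) := one_le_pow₀ one_le_two
      nlinarith
    refine h1.trans ?_
    have : (1 : ℝ) ≤ 3 ^ n := one_le_pow₀ (by norm_num)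
    nlinarith
  obtain ⟨k, ω, hω, hball⟩ := exists_padicDelta_le_iff p z.rep_nonzero m
  obtain ⟨hμ1, hμ2⟩ := muP_ball_bounds p hω hball
  have : Nontrivial (Fin n) := Fin.nontrivial_iff_two_le.2 hn
  obtain ⟨j, hjk⟩ := exists_ne k
  have hq : 0 < p ^ m := pow_pos hp.pos m
  obtain ⟨T₁, hT₁⟩ := exists_forall_le_card_coprimePairs hp.pos hq
    fun d hd => Nat.Coprime.pow_right m hd
  refine ⟨max T₁ (p ^ m), fun T hT => ?_⟩
  rw [max_le_iff] at hT
  obtain ⟨W, hW, hW', hWcard⟩ := exists_primitive_congruenceVectors hp.pos hq hjk hω T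
  obtain ⟨hlo, hup⟩ := ncard_points_bounds p hball T hW hW'
  have hup' := hup.trans (card_congruenceVectors_le hq k ω T)
  have hlo' := hWcard.trans hlo
  have hG := hT₁ T hT.1 fun s => ((1 + p * s) * ω j % (p ^ m : ℕ)).toNat
  have hR := half_div_le_cast_div hq hT.2
  have hqR : (0 : ℝ) < (p ^ m : ℕ) := by exact_mod_cast hq
  have hqT : ((p ^ m : ℕ) : ℝ) ≤ T := by exact_mod_cast hT.2
  have hT0 : (0 : ℝ) < T := hqR.trans_le hqT
  rw [← Nat.cast_pow p m] at hμ1 hμ2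
  obtain ⟨l, rfl⟩ : ∃ l, n = l + 2 := ⟨n - 2, by omega⟩
  rw [show l + 2 - 1 = l + 1 by omega] at *
  rw [show l + 2 - 2 = l by omega] at *
  generalize p ^ m = q at *
  constructor
  · refine le_trans ?_ (Nat.cast_le.2 hlo')
    push_cast
    calc _ ≤ 1 / (32 * p * 2 ^ l) * (T : ℝ) ^ (l + 2) * ((q : ℝ) ^ (l + 1))⁻¹ := by gcongr
      _ = (T : ℝ) ^ 2 / (32 * p * q) * ((T : ℝ) / (2 * q)) ^ l := by
        rw [div_pow, mul_pow]
        field_simp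
        ring
      _ ≤ _ := by gcongr
  · refine (Nat.cast_le.2 hup').trans ?_
    push_cast
    have h1 : (1 : ℝ) ≤ T := by
      have : 0 < T := by exact_mod_cast hT0
      exact_mod_cast this
    have h2 : ((2 * T / q : ℕ) : ℝ) + 1 ≤ 3 * T / q := by
      have h3 : ((2 * T / q : ℕ) : ℝ) ≤ 2 * T / q := by
        refine Nat.cast_div_le.trans ?_
        push_cast
        rfl
      have h4 : (1 : ℝ) ≤ T / q := (one_le_div hqR).2 hqT
      have h5 : (3 : ℝ) * T / q = 2 * T / q + T / q := by ring
      linarith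
    calc (2 * (T : ℝ) + 1) * (((2 * T / q : ℕ) : ℝ) + 1) ^ (l + 1)
        ≤ (3 * T) * (3 * T / q) ^ (l + 1) := by
          gcongr
          linarith
      _ = 3 ^ (l + 2) * p * (T : ℝ) ^ (l + 2) * ((p : ℝ) * q ^ (l + 1))⁻¹ := by
        rw [div_pow, mul_pow]
        field_simp
        ring
      _ ≤ _ := by gcongr
end
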